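/- Liouville theorem: Let f : ℍ → ℍ be an entire slice regular function. If f is bounded, i.e. there is C > 0 with |f(q)| ≤ C for all q ∈ ℍ, then f is constant. -/

import Mathlib

open Quaternion
open scoped InnerProductSpace

/-- The sphere `𝕊` of purely imaginary unit quaternions. -/
def QSphere : Set ℍ := {q : ℍ | q ^ 2 = -1}

/-- The complex plane `ℂ_I` through `1` and `I`. -/
def slicePlane (I : ℍ) : Set ℍ := {q : ℍ | ∃ x y : ℝ, q = (x : ℍ) + y • I}

/-- A real differentiable `f` is (left) slice regular on `U` if on every slice `U ∩ ℂ_I`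
it satisfies the Cauchy-Riemann equation `∂f/∂x + I ∂f/∂y = 0`. -/
def SliceRegularOn (f : ℍ → ℍ) (U : Set ℍ) : Prop :=
  DifferentiableOn ℝ f U ∧
    ∀ I ∈ QSphere, ∀ q ∈ U ∩ slicePlane I,
      fderiv ℝ f q 1 + I * fderiv ℝ f q I = 0

theorem QSphere.norm_eq_one {I : ℍ} (hI : I ∈ QSphere) : ‖I‖ = 1 := by
  have h : ‖I‖ ^ 2 = 1 := by
    rw [← norm_pow, show I ^ 2 = -1 from hI, norm_neg, norm_one]
  exact (pow_eq_one_iff_of_nonneg (norm_nonneg _) two_ne_zero).1 h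

theorem QSphere.re_eq_zero {I : ℍ} (hI : I ∈ QSphere) : I.re = 0 := by
  rw [← sq_eq_neg_normSq, normSq_eq_norm_mul_self, QSphere.norm_eq_one hI]
  simpa using! hI

theorem QSphere.mul_self {I : ℍ} (hI : I ∈ QSphere) : I * I = -1 := by
  rw [← sq]
  exact hI

/-- The embedding of `ℂ` onto the slice `ℂ_I`, sending `Complex.I` to `I`. -/
noncomputable def sliceEmbedding {I : ℍ} (hI : I ∈ QSphere) : ℂ →ₐ[ℝ] ℍ :=
  Complex.liftAux I (QSphere.mul_self hI)

theorem sliceEmbedding_apply {I : ℍ} (hI : I ∈ QSphere) (z : ℂ) :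
    sliceEmbedding hI z = (z.re : ℍ) + z.im • I := rfl

theorem norm_sliceEmbedding {I : ℍ} (hI : I ∈ QSphere) (z : ℂ) :
    ‖sliceEmbedding hI z‖ = ‖z‖ := by
  have h1 : normSq I = 1 := by
    rw [normSq_eq_norm_mul_self, QSphere.norm_eq_one hI, one_mul]
  have h0 := QSphere.re_eq_zero hI
  rw [normSq_def', h0] at h1
  rw [← sq_eq_sq₀ (norm_nonneg _) (norm_nonneg _), sq, ← normSq_eq_norm_mul_self,
    ← Complex.normSq_eq_norm_sq, normSq_def', Complex.normSq_apply, sliceEmbedding_apply]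
  simp only [re_add, re_coe, re_smul, imI_add, imI_coe, imI_smul, imJ_add, imJ_coe, imJ_smul,
    imK_add, imK_coe, imK_smul, h0, smul_eq_mul]
  linear_combination z.im ^ 2 * h1

/-- Left multiplication by the slice `ℂ_I` makes `ℍ` a complex normed space. -/
noncomputable abbrev sliceNormedSpace {I : ℍ} (hI : I ∈ QSphere) : NormedSpace ℂ ℍ where
  toModule := Module.compHom ℍ (sliceEmbedding hI).toRingHom
  norm_smul_le z v := by
    change ‖sliceEmbedding hI z * v‖ ≤ _
    rw [norm_mul, norm_sliceEmbedding]

/-- A bounded entire slice regular function is constant on each slice. -/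
theorem SliceRegularOn.apply_slice_eq_apply_zero {f : ℍ → ℍ} (hf : SliceRegularOn f Set.univ)
    (hb : Bornology.IsBounded (Set.range f)) {I : ℍ} (hI : I ∈ QSphere) (x y : ℝ) :
    f ((x : ℍ) + y • I) = f 0 := by
  let _ := sliceNormedSpace hI
  have smul_def (z : ℂ) (v : ℍ) : z • v = sliceEmbedding hI z * v := rfl
  have : IsScalarTower ℝ ℂ ℍ := ⟨fun r z v ↦ by
    rw [smul_def, smul_def, map_smul, smul_mul_assoc]⟩
  let φ : ℂ →L[ℝ] ℍ := (sliceEmbedding hI).toLinearMap.toContinuousLinearMap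
  have hφ (z : ℂ) : φ z = (z.re : ℍ) + z.im • I := rfl
  have hd : Differentiable ℂ (f ∘ φ) := by
    intro z
    have hz : HasFDerivAt f (fderiv ℝ f (φ z)) (φ z) :=
      (hf.1.differentiableAt Filter.univ_mem).hasFDerivAt
    have hcr := hf.2 I hI (φ z) ⟨Set.mem_univ _, z.re, z.im, rfl⟩
    have hcr' : fderiv ℝ f (φ z) I = I * fderiv ℝ f (φ z) 1 := by
      have h := congrArg (I * ·) hcr
      simp only [mul_add, ← mul_assoc, QSphere.mul_self hI, neg_one_mul, mul_zero] at h
      exact (add_neg_eq_zero.1 h).symm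
    refine (hasFDerivAt_of_restrictScalars ℝ (hz.comp z φ.hasFDerivAt)
      (f' := ContinuousLinearMap.toSpanSingleton ℂ (fderiv ℝ f (φ z) 1)) ?_).differentiableAt
    refine ContinuousLinearMap.ext fun w ↦ ?_
    change w • fderiv ℝ f (φ z) 1 = fderiv ℝ f (φ z) (φ w)
    have hw : φ w = w.re • (1 : ℍ) + w.im • I := by
      rw [hφ, ← coe_mul_eq_smul w.re, mul_one]
    rw [hw, map_add, map_smul, map_smul, hcr', smul_def, sliceEmbedding_apply, add_mul,
      coe_mul_eq_smul, smul_mul_assoc]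
  have h := hd.apply_eq_apply_of_bounded (hb.subset (Set.range_comp_subset_range _ _)) ⟨x, y⟩ 0
  rwa [Function.comp_apply, Function.comp_apply, map_zero, hφ] at h

/-- Every quaternion lies on some slice. -/
theorem exists_mem_slicePlane (q : ℍ) : ∃ I ∈ QSphere, q ∈ slicePlane I := by
  by_cases h : q.im = 0
  · refine ⟨(Complex.I : ℍ), ?_, q.re, 0, ?_⟩
    · change _ ^ 2 = _
      rw [sq, ← coeComplex_mul, Complex.I_mul_I]
      ext <;> simp
    · rw [zero_smul, add_zero]
      simpa [h] using (re_add_im q).symm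
  · have hn : ‖q.im‖ ≠ 0 := norm_ne_zero_iff.2 h
    refine ⟨‖q.im‖⁻¹ • q.im, ?_, q.re, ‖q.im‖, ?_⟩
    · change _ ^ 2 = _
      rw [smul_pow, im_sq, normSq_eq_norm_mul_self, smul_neg, smul_coe, ← sq, ← mul_pow,
        inv_mul_cancel₀ hn, one_pow, coe_one]
    · rw [smul_inv_smul₀ hn, re_add_im]

/-- **Liouville theorem.** A bounded entire slice regular function is constant. -/
theorem liouville (f : ℍ → ℍ) (hf : SliceRegularOn f Set.univ)
    (C : ℝ) (hC : 0 < C) (hbound : ∀ q : ℍ, ‖f q‖ ≤ C) :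
    ∃ c : ℍ, ∀ q : ℍ, f q = c := by
  refine ⟨f 0, fun q ↦ ?_⟩
  obtain ⟨I, hI, x, y, rfl⟩ := exists_mem_slicePlane q
  exact hf.apply_slice_eq_apply_zero
    (isBounded_iff_forall_norm_le.2 ⟨C, Set.forall_mem_range.2 hbound⟩) hI x y
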